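/- arXiv:2007.12538 — 2 statements merged into one kernel-verified Lean document; each statement's English description precedes it below -/
import Mathlib

section
/- Let Γ be a finite group and K/K₀ a Galois algebra for Γ (i.e. K is an étale K₀-algebra with Γ-action making it a Γ-torsor over K₀). Then the first group cohomology H¹(Γ, K^×) vanishes (Hilbert's Theorem 90 for Galois algebras). -/
universe u


namespace HilbertNinety
open scoped Pointwise

theorem orbit_card {K₀ K Γ : Type*} [Field K₀] [CommRing K] [Algebra K₀ K]
    [Group Γ] [Finite Γ] [MulSemiringAction Γ K] [SMulCommClass Γ K₀ K]
    [Algebra.IsInvariant K₀ K Γ] (Q R : Ideal K) [Q.IsPrime] [R.IsPrime] :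
    ∃ g : Γ, R = g • Q := by
  refine Algebra.IsInvariant.exists_smul_of_under_eq K₀ K Γ Q R ?_
  have h1 := Ideal.eq_bot_of_prime (Q.under K₀)
  have h2 := Ideal.eq_bot_of_prime (R.under K₀)
  rw [h1, h2]

attribute [local instance] Ideal.Quotient.field in
theorem card_aut {K₀ K Γ : Type*} [Field K₀] [CommRing K] [Algebra K₀ K]
    [Group Γ] [Finite Γ] [MulSemiringAction Γ K] [SMulCommClass Γ K₀ K]
    [FiniteDimensional K₀ K] [Algebra.IsInvariant K₀ K Γ] (Q : Ideal K) [Q.IsMaximal]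
    [Algebra.IsSeparable K₀ (K ⧸ Q)] :
    Nat.card ((K ⧸ Q) ≃ₐ[K₀ ⧸ Q.under K₀] (K ⧸ Q)) = Module.finrank K₀ (K ⧸ Q) := by
  have : (Q.under K₀).IsMaximal := by
    rw [Ideal.eq_bot_of_prime (Q.under K₀)]; exact Ideal.bot_isMaximal
  have : Normal (K₀ ⧸ Q.under K₀) (K ⧸ Q) := Ideal.Quotient.normal Γ (Q.under K₀) Q
  have : Algebra.IsSeparable (K₀ ⧸ Q.under K₀) (K ⧸ Q) :=
    Algebra.isSeparable_tower_top_of_isSeparable K₀ _ _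
  have : IsGalois (K₀ ⧸ Q.under K₀) (K ⧸ Q) := {}
  have : Module.Finite (K₀ ⧸ Q.under K₀) (K ⧸ Q) := Module.Finite.of_restrictScalars_finite K₀ _ _
  have h := IsGalois.card_aut_eq_finrank (K₀ ⧸ Q.under K₀) (K ⧸ Q)
  have hm := Module.finrank_mul_finrank K₀ (K₀ ⧸ Q.under K₀) (K ⧸ Q)
  have h1 : Module.finrank K₀ (K₀ ⧸ Q.under K₀) = 1 := by
    rw [Ideal.eq_bot_of_prime (Q.under K₀),
      (AlgEquiv.quotientBot K₀ K₀).toLinearEquiv.finrank_eq, Module.finrank_self]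
  rw [h, ← hm, h1, one_mul]

theorem finrank_smul {K₀ K Γ : Type*} [Field K₀] [CommRing K] [Algebra K₀ K]
    [Group Γ] [MulSemiringAction Γ K] [SMulCommClass Γ K₀ K] (Q : Ideal K) (g : Γ) :
    Module.finrank K₀ (K ⧸ (g • Q)) = Module.finrank K₀ (K ⧸ Q) :=
  (Ideal.quotientEquivAlg Q (g • Q) (MulSemiringAction.toAlgEquiv K₀ K g)
    rfl).toLinearEquiv.finrank_eq.symm

theorem finrank_eq_sum {K₀ K : Type*} [Field K₀] [CommRing K] [Algebra K₀ K]
    [FiniteDimensional K₀ K] [IsReduced K] [IsArtinianRing K] [Fintype (MaximalSpectrum K)] :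
    Module.finrank K₀ K = ∑ m : MaximalSpectrum K, Module.finrank K₀ (K ⧸ m.asIdeal) := by
  rw [← Module.finrank_pi_fintype]
  exact (AlgEquiv.ofRingEquiv (f := IsArtinianRing.equivPi K)
    (fun _ => rfl) : K ≃ₐ[K₀] _).toLinearEquiv.finrank_eq

theorem inertia_trivial {K₀ : Type*} {K : Type*} {Γ : Type*} [Field K₀] [CommRing K] [Algebra K₀ K]
    [Group Γ] [Finite Γ] [MulSemiringAction Γ K] [SMulCommClass Γ K₀ K]
    [FiniteDimensional K₀ K] [IsReduced K] [Algebra.IsInvariant K₀ K Γ]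
    (hdim : Module.finrank K₀ K = Nat.card Γ)
    (Q : Ideal K) [Q.IsMaximal] [Algebra.IsSeparable K₀ (K ⧸ Q)] (g : Γ)
    (hg : ∀ x, g • x - x ∈ Q) : g = 1 := by
  have : IsArtinianRing K := .of_finite K₀ K
  have : Fintype (MaximalSpectrum K) := Fintype.ofFinite _
  have hfr : Module.finrank K₀ K =
      Nat.card (MaximalSpectrum K) * Module.finrank K₀ (K ⧸ Q) := by
    rw [finrank_eq_sum, Finset.sum_congr rfl (g := fun _ => Module.finrank K₀ (K ⧸ Q)),
      Finset.sum_const, Finset.card_univ, smul_eq_mul, Nat.card_eq_fintype_card]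
    intro m _
    obtain ⟨h, hh⟩ := orbit_card (K₀ := K₀) (Γ := Γ) Q m.asIdeal
    rw [hh, finrank_smul]
  have horb : Nat.card (MulAction.orbit Γ Q) = Nat.card (MaximalSpectrum K) := by
    refine Nat.card_congr (Equiv.ofBijective
      (fun x => (⟨x.1, ?_⟩ : MaximalSpectrum K)) ⟨?_, ?_⟩)
    · obtain ⟨_, h, rfl⟩ := x
      have : (h • Q).IsPrime := Ideal.IsPrime.smul h
      exact IsArtinianRing.isMaximal_of_isPrime (h • Q)
    · intro x y hxy
      exact Subtype.ext (congrArg MaximalSpectrum.asIdeal hxy)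
    · intro m
      obtain ⟨h, hh⟩ := orbit_card (K₀ := K₀) (Γ := Γ) Q m.asIdeal
      exact ⟨⟨m.asIdeal, h, hh.symm⟩, rfl⟩
  have hprod : Nat.card (MulAction.orbit Γ Q) * Nat.card (MulAction.stabilizer Γ Q) =
      Nat.card Γ := by
    rw [← Nat.card_prod]
    exact Nat.card_congr (MulAction.orbitProdStabilizerEquivGroup Γ Q)
  have hst : Nat.card (MulAction.stabilizer Γ Q) =
      Nat.card ((K ⧸ Q) ≃ₐ[K₀ ⧸ Q.under K₀] (K ⧸ Q)) := by
    rw [card_aut (Γ := Γ)]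
    have hne : Nat.card (MaximalSpectrum K) ≠ 0 := by
      rw [← horb]
      intro h0
      rw [h0, zero_mul] at hprod
      exact Nat.card_pos.ne hprod
    refine Nat.eq_of_mul_eq_mul_left (Nat.pos_of_ne_zero hne) ?_
    rw [← hfr, hdim, ← hprod, horb]
  have hsurj := Ideal.Quotient.stabilizerHom_surjective Γ (Q.under K₀) Q
  have hinj := (hsurj.bijective_of_nat_card_le hst.le).1
  have hmem : g ∈ MulAction.stabilizer Γ Q := Ideal.inertia_le_stabilizer Q hg
  have : (⟨g, hmem⟩ : MulAction.stabilizer Γ Q) = 1 := by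
    apply hinj
    rw [map_one]
    ext x
    obtain ⟨x, rfl⟩ := Ideal.Quotient.mk_surjective x
    exact Ideal.Quotient.eq.mpr (hg x)
  exact congrArg Subtype.val this

end HilbertNinety

/-- Hilbert's Theorem 90 for Galois algebras: if `K` is a Galois algebra over the field `K₀`
for the finite group `Γ` (an étale `K₀`-algebra with `Γ`-action by `K₀`-algebra automorphisms,
of dimension `|Γ|`, whose `Γ`-fixed elements are exactly `K₀`), then `H¹(Γ, Kˣ)` vanishes:
every 1-cocycle with values in `Kˣ` is a 1-coboundary. -/
theorem hilbert90_for_galois_algebras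
    (K₀ : Type u) [Field K₀] (K : Type u) [CommRing K] [Algebra K₀ K]
    (Γ : Type*) [Group Γ] [Finite Γ]
    [MulSemiringAction Γ K] [SMulCommClass Γ K₀ K]
    [FiniteDimensional K₀ K] [Algebra.FormallyEtale K₀ K]
    (hdim : Module.finrank K₀ K = Nat.card Γ)
    (hfix : ∀ x : K, (∀ g : Γ, g • x = x) → x ∈ (algebraMap K₀ K).range)
    (f : Γ → Kˣ)
    (hf : ∀ g h : Γ, ((f (g * h) : K)) = (f g : K) * g • (f h : K)) :
    ∃ β : Kˣ, ∀ g : Γ, (f g : K) = (g • (β : K)) * (↑β⁻¹ : K) := by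
  have hinv : Algebra.IsInvariant K₀ K Γ := ⟨fun x hx => hfix x hx⟩
  have hred : IsReduced K := Algebra.FormallyUnramified.isReduced_of_field K₀ K
  have : Nontrivial K := by
    by_contra h
    rw [not_nontrivial_iff_subsingleton] at h
    rw [Module.finrank_zero_of_subsingleton] at hdim
    exact Nat.card_pos.ne hdim
  have := Fintype.ofFinite Γ
  obtain ⟨Q, hQ⟩ := Ideal.exists_maximal K
  have hdom : IsDomain (K ⧸ Q) := inferInstance
  let φ : Γ → (K →* (K ⧸ Q)) := fun g =>
    ((Ideal.Quotient.mk Q).comp (MulSemiringAction.toRingHom Γ K g) : K →+* (K ⧸ Q))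
  have hφ : Function.Injective φ := by
    intro g h hgh
    have : g * h⁻¹ = 1 := by
      refine HilbertNinety.inertia_trivial hdim Q _ fun x => ?_
      have := DFunLike.congr_fun hgh (h⁻¹ • x)
      have h2 : Ideal.Quotient.mk Q (g • h⁻¹ • x) = Ideal.Quotient.mk Q (h • h⁻¹ • x) := this
      rw [smul_inv_smul, ← mul_smul] at h2
      exact Ideal.Quotient.eq.mp h2
    exact mul_inv_eq_one.mp this
  have hli := (linearIndependent_monoidHom K (K ⧸ Q)).comp φ hφ
  have hex : ∃ c : K, ∑ g : Γ, (f g : K) * g • c ∉ Q := by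
    by_contra! hcon
    rw [Fintype.linearIndependent_iff] at hli
    have h0 := hli (fun g => Ideal.Quotient.mk Q (f g : K)) (by
      ext c
      have := Ideal.Quotient.eq_zero_iff_mem.mpr (hcon c)
      rw [map_sum] at this
      simpa [φ, Finset.sum_apply] using this) 1
    exact ((f 1).isUnit.map (Ideal.Quotient.mk Q)).ne_zero h0
  obtain ⟨c, hc⟩ := hex
  set b : K := ∑ g : Γ, (f g : K) * g • c with hb
  have hfb : ∀ h : Γ, (f h : K) * h • b = b := by
    intro h
    rw [hb, Finset.smul_sum, Finset.mul_sum]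
    refine Fintype.sum_equiv (Equiv.mulLeft h) _ _ fun g => ?_
    simp only [Equiv.coe_mulLeft, hf, smul_mul', mul_smul, mul_assoc]
  have hunit : IsUnit b := by
    by_contra hnu
    obtain ⟨M, hM, hbM⟩ := exists_max_ideal_of_mem_nonunits hnu
    obtain ⟨g, hg⟩ := HilbertNinety.orbit_card (K₀ := K₀) (Γ := Γ) M Q
    apply hc
    rw [← hfb g, hg]
    exact Ideal.mul_mem_left _ _ (Ideal.smul_mem_pointwise_smul g b M hbM)
  obtain ⟨u, hu⟩ := hunit
  refine ⟨u⁻¹, fun g => ?_⟩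
  have h1 : (g • (u : K)) * (g • ((u⁻¹ : Kˣ) : K)) = 1 := by
    rw [← smul_mul', Units.mul_inv, smul_one]
  have h2 := hfb g
  rw [← hu] at h2
  rw [inv_inv]
  calc (f g : K) = (f g : K) * ((g • (u : K)) * (g • ((u⁻¹ : Kˣ) : K))) := by rw [h1, mul_one]
    _ = _ := by rw [← mul_assoc, h2, mul_comm]
end

section
/- Let G be a finite abelian group of rank r acting faithfully and diagonally on d-dimensional vector spaces V and W (r ≤ d) over an algebraically closed field of characteristic zero, via characters χ₁,…,χ_d and η₁,…,η_d respectively. If projective equivariant compactifications of V and W are G-equivariantly birational, then χ₁ ∧ ⋯ ∧ χ_d = ± η₁ ∧ ⋯ ∧ η_d in the d-th exterior power ⋀^d(G^∨) of the character group. In particular, when r = d, the condition χ₁ ∧ ⋯ ∧ χ_d = ± η₁ ∧ ⋯ ∧ η_d is a necessary condition, and it is nontrivial. -/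
open MvPolynomial

theorem ry_sum_order {Γ k ι : Type*} [AddCommGroup Γ] [LinearOrder Γ] [IsOrderedAddMonoid Γ] [Field k]
    (s : Finset ι) (hs : s.Nonempty) (f : ι → HahnSeries Γ k) (h0 : ∀ i ∈ s, f i ≠ 0)
    (hinj : ∀ i ∈ s, ∀ j ∈ s, (f i).order = (f j).order → i = j) :
    (∑ i ∈ s, f i) ≠ 0 ∧ ∃ i ∈ s, (∑ i ∈ s, f i).order = (f i).order := by
  obtain ⟨i, hi, hmin⟩ := s.exists_min_image (fun i => (f i).order) hs
  have hc : ∀ g, g ≤ (f i).order → (∑ i ∈ s, f i).coeff g = (f i).coeff g := by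
    intro g hg
    rw [HahnSeries.coeff_sum]
    refine Finset.sum_eq_single_of_mem i hi fun j hj hji => ?_
    apply HahnSeries.coeff_eq_zero_of_lt_order
    refine hg.trans_lt (lt_of_le_of_ne (hmin j hj) fun h => hji (hinj j hj i hi h.symm))
  have hne : (∑ i ∈ s, f i).coeff (f i).order ≠ 0 := by
    rw [hc _ le_rfl]
    exact fun h => h0 i hi (HahnSeries.coeff_order_eq_zero.1 h)
  have hne' : (∑ i ∈ s, f i) ≠ 0 := fun h => hne (by rw [h]; simp)
  refine ⟨hne', i, hi, le_antisymm (HahnSeries.order_le_of_coeff_ne_zero hne) ?_⟩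
  rw [HahnSeries.le_order_iff_forall hne']
  intro j hj
  rw [hc j hj.le]
  exact HahnSeries.coeff_eq_zero_of_lt_order hj

theorem ry_order_prod {Γ k ι : Type*} [AddCommGroup Γ] [LinearOrder Γ] [IsOrderedAddMonoid Γ] [Field k]
    (s : Finset ι) (f : ι → HahnSeries Γ k) (h0 : ∀ i ∈ s, f i ≠ 0) :
    (∏ i ∈ s, f i).order = ∑ i ∈ s, (f i).order := by
  classical
  induction s using Finset.induction_on with
  | empty => simp
  | insert a s ha ih =>
    rw [Finset.prod_insert ha, Finset.sum_insert ha, HahnSeries.order_mul, ih]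
    · exact fun i hi => h0 i (Finset.mem_insert_of_mem hi)
    · exact h0 a (Finset.mem_insert_self _ _)
    · exact Finset.prod_ne_zero_iff.2 fun i hi => h0 i (Finset.mem_insert_of_mem hi)

theorem ry_order_poly {Γ k : Type*} [AddCommGroup Γ] [LinearOrder Γ] [IsOrderedAddMonoid Γ] [Field k]
    {d : ℕ} (ψ : MvPolynomial (Fin d) k →ₐ[k] HahnSeries Γ k)
    (h0 : ∀ i, ψ (X i) ≠ 0) (hli : LinearIndependent ℤ fun i => (ψ (X i)).order)
    (p : MvPolynomial (Fin d) k) (hp : p ≠ 0) :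
    ψ p ≠ 0 ∧ ∃ c : Fin d → ℤ, (ψ p).order = ∑ i, c i • (ψ (X i)).order := by
  have hm : ∀ s ∈ p.support, ψ (monomial s (p.coeff s)) ≠ 0 ∧
      (ψ (monomial s (p.coeff s))).order = ∑ i, (s i : ℤ) • (ψ (X i)).order := by
    intro s hs
    have hs' : p.coeff s ≠ 0 := mem_support_iff.1 hs
    have e1 : ψ (monomial s (p.coeff s)) = HahnSeries.C (p.coeff s) * ∏ i, ψ (X i) ^ s i := by
      rw [monomial_eq, Finsupp.prod_fintype _ _ (by simp), map_mul, map_prod]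
      congr 1
      · rw [← algebraMap_eq, AlgHom.commutes]; rfl
      · simp
    have hC : (HahnSeries.C (p.coeff s) : HahnSeries Γ k) ≠ 0 := by
      simpa using hs'
    have hP : ∏ i, ψ (X i) ^ s i ≠ 0 := Finset.prod_ne_zero_iff.2 fun i _ => pow_ne_zero _ (h0 i)
    rw [e1]
    refine ⟨mul_ne_zero hC hP, ?_⟩
    rw [HahnSeries.order_mul hC hP, ry_order_prod _ _ fun i _ => pow_ne_zero _ (h0 i)]
    simp [HahnSeries.order_single hs']
  have hsum : ψ p = ∑ s ∈ p.support, ψ (monomial s (p.coeff s)) := by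
    conv_lhs => rw [p.as_sum]
    rw [map_sum]
  obtain ⟨h1, s, hs, h2⟩ := ry_sum_order p.support (support_nonempty.2 hp)
    (fun s => ψ (monomial s (p.coeff s))) (fun s hs => (hm s hs).1) (by
      intro s hs t ht hst
      rw [(hm s hs).2, (hm t ht).2] at hst
      ext i
      have := Fintype.linearIndependent_iff.1 hli (fun i => (s i : ℤ) - t i) (by
        simp only [sub_smul, Finset.sum_sub_distrib]
        exact sub_eq_zero.2 hst) i
      omega)
  rw [hsum]
  refine ⟨h1, fun i => (s i : ℤ), ?_⟩
  rw [h2, (hm s hs).2]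

theorem ry_wedge {A B : Type*} [AddCommGroup A] [AddCommGroup B] {d : ℕ}
    (f : A [⋀^Fin d]→ₗ[ℤ] B) (η : Fin d → A) (N : Matrix (Fin d) (Fin d) ℤ) :
    f (fun i => ∑ j, N i j • η j) = N.det • f η := by
  have key : f.compLinearMap (Fintype.linearCombination ℤ η) =
      (Matrix.detRowAlternating (R := ℤ) (n := Fin d)).smulRight (f η) := by
    refine Module.Basis.ext_alternating (Pi.basisFun ℤ (Fin d)) fun v hv => ?_
    let σ : Equiv.Perm (Fin d) := Equiv.ofBijective v (Finite.injective_iff_bijective.1 hv)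
    have hσ : v = σ := rfl
    have h1 := (f.compLinearMap (Fintype.linearCombination ℤ η)).map_perm (Pi.basisFun ℤ (Fin d)) σ
    have h2 := ((Matrix.detRowAlternating (R := ℤ) (n := Fin d)).smulRight (f η)).map_perm
      (Pi.basisFun ℤ (Fin d)) σ
    simp only [hσ]
    refine h1.trans (Eq.trans ?_ h2.symm)
    congr 1
    have h3 : Matrix.detRowAlternating (R := ℤ) (Pi.basisFun ℤ (Fin d)) = 1 := by
      rw [← Matrix.det_one (n := Fin d) (R := ℤ)]
      change Matrix.det _ = Matrix.det _
      congr 1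
      ext i j
      simp [Matrix.one_apply, Pi.single_apply, eq_comm]
    have h4 : (fun i => (Fintype.linearCombination ℤ η) ((Pi.basisFun ℤ (Fin d)) i)) = η := by
      ext i
      simp [Fintype.linearCombination_apply, Pi.single_apply]
    have h5 : ((Matrix.detRowAlternating (R := ℤ) (n := Fin d)).smulRight (f η))
      (Pi.basisFun ℤ (Fin d)) = Matrix.detRowAlternating (R := ℤ) (Pi.basisFun ℤ (Fin d)) • f η := rfl
    rw [h5, h3, one_smul]
    exact congrArg f h4
  have := congrArg (fun g => g N) key
  exact this

theorem ry_twist {Γ k : Type*} [AddCommGroup Γ] [LinearOrder Γ] [IsOrderedAddMonoid Γ] [Field k]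
    (T : Γ → kˣ) (x y : HahnSeries Γ k) (h : ∀ a, y.coeff a = T a * x.coeff a) :
    y.leadingCoeff = T x.order * x.leadingCoeff := by
  by_cases hx : x = 0
  · have hy : y = 0 := by
      ext a; rw [h, hx]; simp
    simp [hx, hy]
  have h1 : y.coeff x.order ≠ 0 := by
    rw [h]
    exact mul_ne_zero (Units.ne_zero _) fun h => hx (HahnSeries.coeff_order_eq_zero.1 h)
  have hy : y ≠ 0 := fun h => h1 (by rw [h]; simp)
  have ho : y.order = x.order := by
    refine le_antisymm (HahnSeries.order_le_of_coeff_ne_zero h1) ?_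
    rw [HahnSeries.le_order_iff_forall hy]
    intro j hj
    rw [h, HahnSeries.coeff_eq_zero_of_lt_order hj, mul_zero]
  rw [HahnSeries.leadingCoeff_eq, HahnSeries.leadingCoeff_eq, ho, h]

/-- The embedding of polynomials into the lexicographic Hahn series field. -/
noncomputable def ryEmb (k : Type*) [Field k] (d : ℕ) :
    MvPolynomial (Fin d) k →ₐ[k] HahnSeries (Lex (Fin d → ℤ)) k :=
  aeval fun i => HahnSeries.single (toLex (Pi.single i 1)) 1

theorem ryEmb_X (k : Type*) [Field k] (d : ℕ) (i : Fin d) :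
    ryEmb k d (X i) = HahnSeries.single (toLex (Pi.single i 1)) 1 := by
  simp [ryEmb]

theorem ryEmb_order_X (k : Type*) [Field k] (d : ℕ) (i : Fin d) :
    (ryEmb k d (X i)).order = toLex (Pi.single i 1) := by
  rw [ryEmb_X, HahnSeries.order_single one_ne_zero]

theorem ryEmb_ne (k : Type*) [Field k] (d : ℕ) (p : MvPolynomial (Fin d) k) (hp : p ≠ 0) :
    ryEmb k d p ≠ 0 := by
  refine (ry_order_poly (ryEmb k d) (fun i => ?_) ?_ p hp).1
  · rw [ryEmb_X]; simp
  · simp only [ryEmb_order_X]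
    have h := (Pi.basisFun ℤ (Fin d)).linearIndependent
    have he : (⇑(Pi.basisFun ℤ (Fin d)) : Fin d → Fin d → ℤ) = fun i => Pi.single i 1 := by
      ext i j
      simp
    rw [he] at h
    exact h

/-- The character value attached to an exponent vector. -/
def ryT {k : Type*} [Field k] {d : ℕ} (c : Fin d → kˣ) (a : Lex (Fin d → ℤ)) : kˣ :=
  ∏ j, c j ^ (ofLex a j)

theorem ryT_add {k : Type*} [Field k] {d : ℕ} (c : Fin d → kˣ) (a b : Lex (Fin d → ℤ)) :
    ryT c (a + b) = ryT c a * ryT c b := by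
  rw [ryT, ryT, ryT, ← Finset.prod_mul_distrib]
  exact Finset.prod_congr rfl fun j _ => zpow_add _ _ _

theorem ryEmb_monomial (k : Type*) [Field k] (d : ℕ) (s : Fin d →₀ ℕ) (r : k) :
    ryEmb k d (monomial s r) = HahnSeries.single (toLex fun i => (s i : ℤ)) r := by
  induction s using Finsupp.induction_linear generalizing r with
  | zero =>
    rw [monomial_zero', ← algebraMap_eq, AlgHom.commutes]
    rfl
  | add s t hs ht =>
    rw [← mul_one r, ← monomial_mul, map_mul, hs, ht, HahnSeries.single_mul_single]
    congr 2
  | single i n =>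
    have : monomial (Finsupp.single i n) r = (C r * X i ^ n : MvPolynomial (Fin d) k) := by
      rw [monomial_eq]; simp
    rw [this, map_mul, map_pow, ryEmb_X, HahnSeries.single_pow, ← algebraMap_eq, AlgHom.commutes]
    change HahnSeries.single 0 r * _ = _
    rw [HahnSeries.single_mul_single, one_pow, mul_one, zero_add]
    congr 2
    apply ofLex.injective
    funext j
    change (n • (Pi.single i 1 : Fin d → ℤ)) j = ((Finsupp.single i n) j : ℤ)
    by_cases h : i = j
    · subst h; simp
    · simp [Ne.symm h]

theorem ryEmb_coeff (k : Type*) [Field k] (d : ℕ) (c : Fin d → kˣ) (p : MvPolynomial (Fin d) k)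
    (a : Lex (Fin d → ℤ)) :
    (ryEmb k d (aeval (fun i => C (c i : k) * X i) p)).coeff a =
      (ryT c a : k) * (ryEmb k d p).coeff a := by
  induction p using MvPolynomial.induction_on' with
  | add p q hp hq => simp only [map_add, HahnSeries.coeff_add, hp, hq, mul_add]
  | monomial s r =>
    have : aeval (fun i => C (c i : k) * X i) (monomial s r) =
        monomial (σ := Fin d) s (r * ∏ i, (c i : k) ^ s i) := by
      rw [aeval_monomial, Finsupp.prod_fintype _ _ (by simp), monomial_eq,
        Finsupp.prod_fintype _ _ (by simp)]
      simp [mul_pow, Finset.prod_mul_distrib, mul_assoc, algebraMap_eq]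
    rw [this, ryEmb_monomial, ryEmb_monomial]
    by_cases h : a = toLex fun i => (s i : ℤ)
    · subst h
      simp [ryT, mul_comm]
    · rw [HahnSeries.coeff_single_of_ne h, HahnSeries.coeff_single_of_ne h, mul_zero]

theorem ry_half
    (k : Type*) [Field k]
    (G : Type*) [CommGroup G]
    (d : ℕ)
    (χ η : Fin d → (G →* kˣ))
    (L : Type*) [Field L] [Algebra (MvPolynomial (Fin d) k) L]
    [IsFractionRing (MvPolynomial (Fin d) k) L]
    [Algebra k L] [IsScalarTower k (MvPolynomial (Fin d) k) L]
    (ρV ρW : G →* (L ≃ₐ[k] L))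
    (hρV : ∀ (g : G) (i : Fin d),
      ρV g (algebraMap (MvPolynomial (Fin d) k) L (MvPolynomial.X i)) =
        (χ i g : k) • algebraMap (MvPolynomial (Fin d) k) L (MvPolynomial.X i))
    (hρW : ∀ (g : G) (i : Fin d),
      ρW g (algebraMap (MvPolynomial (Fin d) k) L (MvPolynomial.X i)) =
        (η i g : k) • algebraMap (MvPolynomial (Fin d) k) L (MvPolynomial.X i))
    (e : L ≃ₐ[k] L)
    (he : ∀ (g : G) (x : L), e (ρV g x) = ρW g (e x)) :
    ∃ m : ℤ, (m = 0 ∨ m = 1 ∨ m = -1) ∧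
    ExteriorAlgebra.ιMulti ℤ d (fun i => Additive.ofMul (χ i)) =
      m • ExteriorAlgebra.ιMulti ℤ d (fun i => Additive.ofMul (η i)) := by
  have hinj : Function.Injective (ryEmb k d) := by
    rw [injective_iff_map_eq_zero]
    intro p hp
    by_contra h
    exact ryEmb_ne k d p h hp
  let φ : L →ₐ[k] HahnSeries (Lex (Fin d → ℤ)) k := IsFractionRing.liftAlgHom hinj
  have hφ : ∀ p, φ (algebraMap (MvPolynomial (Fin d) k) L p) = ryEmb k d p := fun p => IsFractionRing.lift_algebraMap hinj p
  have hinjA : Function.Injective (algebraMap (MvPolynomial (Fin d) k) L) :=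
    IsFractionRing.injective _ _
  have hρ : ∀ (g : G) (p : MvPolynomial (Fin d) k), ρW g (algebraMap (MvPolynomial (Fin d) k) L p) =
      algebraMap (MvPolynomial (Fin d) k) L (aeval (fun i => C (η i g : k) * X i) p) := by
    intro g p
    have : ((ρW g : L →ₐ[k] L).comp (IsScalarTower.toAlgHom k (MvPolynomial (Fin d) k) L)) =
      (IsScalarTower.toAlgHom k (MvPolynomial (Fin d) k) L).comp
        (aeval (fun i => C (η i g : k) * X i)) := by
      apply MvPolynomial.algHom_ext
      intro i
      simp only [AlgHom.comp_apply, aeval_X, ← smul_eq_C_mul, map_smul]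
      exact hρW g i
    exact DFunLike.congr_fun this p
  let z : Fin d → L := fun i => e (algebraMap (MvPolynomial (Fin d) k) L (X i))
  have hz0 : ∀ i, z i ≠ 0 := fun i => by
    simp only [z, ne_eq, EmbeddingLike.map_eq_zero_iff]
    rw [map_eq_zero_iff _ hinjA]
    exact X_ne_zero i
  have hz : ∀ g i, ρW g (z i) = (χ i g : k) • z i := fun g i => by
    simp only [z]
    rw [← he, hρV, map_smul]
  let N : Matrix (Fin d) (Fin d) ℤ := fun i => ofLex (φ (z i)).order
  -- weights
  have hT : ∀ g i, χ i g = ryT (fun j => η j g) (φ (z i)).order := by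
    intro g i
    obtain ⟨p, q, hq, hpq⟩ := IsFractionRing.div_surjective (MvPolynomial (Fin d) k) (z i)
    have hq0 : q ≠ 0 := nonZeroDivisors.ne_zero hq
    have hqL : algebraMap (MvPolynomial (Fin d) k) L q ≠ 0 := by rwa [ne_eq, map_eq_zero_iff _ hinjA]
    have hp' : algebraMap (MvPolynomial (Fin d) k) L p = z i * algebraMap (MvPolynomial (Fin d) k) L q := by
      rw [← hpq, div_mul_cancel₀ _ hqL]
    have hp0 : p ≠ 0 := by
      rintro rfl
      rw [map_zero] at hp'
      exact mul_ne_zero (hz0 i) hqL hp'.symm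
    have h1 := congrArg φ hp'
    rw [map_mul, hφ, hφ] at h1
    have h2 := congrArg (fun x => φ (ρW g x)) hp'
    simp only [map_mul, hρ, hφ, hz, map_smul] at h2
    have l1 := congrArg HahnSeries.leadingCoeff h1
    have l2 := congrArg HahnSeries.leadingCoeff h2
    have hzi : φ (z i) ≠ 0 := by simpa using hz0 i
    have o1 := congrArg HahnSeries.order h1
    rw [HahnSeries.order_mul hzi (ryEmb_ne k d q hq0)] at o1
    rw [← HahnSeries.C_mul_eq_smul, HahnSeries.leadingCoeff_mul, HahnSeries.leadingCoeff_mul,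
      ry_twist (ryT fun j => η j g) _ _ (ryEmb_coeff k d _ p),
      ry_twist (ryT fun j => η j g) _ _ (ryEmb_coeff k d _ q), o1, ryT_add, l1,
      HahnSeries.leadingCoeff_mul] at l2
    have hc1 : (φ (z i)).leadingCoeff ≠ 0 := HahnSeries.leadingCoeff_ne_zero.2 hzi
    have hc2 : (ryEmb k d q).leadingCoeff ≠ 0 :=
      HahnSeries.leadingCoeff_ne_zero.2 (ryEmb_ne k d q hq0)
    have hc3 : (ryT (fun j => η j g) (ryEmb k d q).order : k) ≠ 0 := Units.ne_zero _
    have hcc : (HahnSeries.C (χ i g : k) : HahnSeries (Lex (Fin d → ℤ)) k).leadingCoeff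
        = (χ i g : k) := HahnSeries.leadingCoeff_of_single
    rw [hcc] at l2
    push_cast at l2
    ext
    apply mul_right_cancel₀ (mul_ne_zero hc3 (mul_ne_zero hc1 hc2))
    linear_combination -l2
  have hχN : (fun i => Additive.ofMul (χ i)) = fun i => ∑ j, N i j • Additive.ofMul (η j) := by
    funext i
    apply Additive.toMul.injective
    rw [toMul_sum]
    ext g
    rw [toMul_ofMul, hT g i]
    simp [ryT, N, MonoidHom.finsetProd_apply]
  refine ⟨N.det, ?_, ?_⟩
  · by_cases hdet : N.det = 0
    · exact Or.inl hdet
    right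
    let ψ : MvPolynomial (Fin d) k →ₐ[k] HahnSeries (Lex (Fin d → ℤ)) k :=
      (φ.comp (e : L →ₐ[k] L)).comp (IsScalarTower.toAlgHom k (MvPolynomial (Fin d) k) L)
    have hψ : ∀ p, ψ p = φ (e (algebraMap (MvPolynomial (Fin d) k) L p)) := fun p => rfl
    have hli : LinearIndependent ℤ fun i => (ψ (X i)).order :=
      Matrix.linearIndependent_rows_of_det_ne_zero hdet
    have hψp := ry_order_poly ψ (fun i => by simp [hψ]) hli
    have hrow : ∀ j, ∃ c : Fin d → ℤ, ∑ i, c i • (ψ (X i)).order = toLex (Pi.single j 1) := by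
      intro j
      obtain ⟨p, q, hq, hpq⟩ := IsFractionRing.div_surjective (MvPolynomial (Fin d) k)
        (e.symm (algebraMap (MvPolynomial (Fin d) k) L (X j)))
      have hq0 : q ≠ 0 := nonZeroDivisors.ne_zero hq
      have hqL : algebraMap (MvPolynomial (Fin d) k) L q ≠ 0 := by rwa [ne_eq, map_eq_zero_iff _ hinjA]
      have hp' : algebraMap (MvPolynomial (Fin d) k) L p = e.symm (algebraMap (MvPolynomial (Fin d) k) L (X j)) * algebraMap (MvPolynomial (Fin d) k) L q := by
        rw [← hpq, div_mul_cancel₀ _ hqL]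
      have h1 := congrArg (fun x => φ (e x)) hp'
      simp only [map_mul, AlgEquiv.apply_symm_apply, hφ, ← hψ] at h1
      have hX : ryEmb k d (X j) ≠ 0 := ryEmb_ne k d _ (X_ne_zero j)
      obtain ⟨hq1, b, hb⟩ := hψp q hq0
      have hp0 : p ≠ 0 := by
        rintro rfl
        rw [map_zero] at h1
        exact mul_ne_zero hX hq1 h1.symm
      obtain ⟨hp1, a, ha⟩ := hψp p hp0
      have o1 := congrArg HahnSeries.order h1
      rw [HahnSeries.order_mul hX hq1, ryEmb_order_X, ha, hb] at o1
      refine ⟨fun i => a i - b i, ?_⟩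
      simp only [sub_smul, Finset.sum_sub_distrib, o1, add_sub_cancel_right]
    choose c hc using hrow
    have hCN : (Matrix.of c) * N = 1 := by
      ext j l
      have := congrArg (fun v : Lex (Fin d → ℤ) => ofLex v l) (hc j)
      rw [Matrix.mul_apply, Matrix.one_apply]
      have h6 : (∑ i, c j i • N i) l = (Pi.single j 1 : Fin d → ℤ) l := this
      rw [Finset.sum_apply] at h6
      simpa [Pi.single_apply, eq_comm] using h6
    have hu : IsUnit N.det := by
      have := congrArg Matrix.det hCN
      rw [Matrix.det_mul, Matrix.det_one] at this
      exact IsUnit.of_mul_eq_one_right _ this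
    exact Int.isUnit_iff.1 hu
  · rw [hχN]
    exact ry_wedge _ _ _

/-- Reichstein–Youssin necessary condition: let `G` be a finite abelian group acting
faithfully and diagonally on two `d`-dimensional vector spaces over an algebraically closed
field `k` of characteristic zero, via characters `χ₁, …, χ_d` and `η₁, …, η_d`.  If the two
actions on the rational function field `L = k(x₁, …, x_d)` (induced on projective equivariant
compactifications) are `G`-equivariantly birational, i.e. there is a `G`-equivariant
`k`-algebra automorphism `e` of `L` intertwining them, then
`χ₁ ∧ ⋯ ∧ χ_d = ± η₁ ∧ ⋯ ∧ η_d` in `⋀^d` of the character group (viewed inside the exterior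
algebra over `ℤ` of the additive character group). -/
theorem reichstein_youssin_necessary_condition
    (k : Type*) [Field k] [IsAlgClosed k] [CharZero k]
    (G : Type*) [CommGroup G] [Finite G]
    (d : ℕ)
    (χ η : Fin d → (G →* kˣ))
    (hχ : ∀ g : G, (∀ i, χ i g = 1) → g = 1)
    (hη : ∀ g : G, (∀ i, η i g = 1) → g = 1)
    (L : Type*) [Field L] [Algebra (MvPolynomial (Fin d) k) L]
    [IsFractionRing (MvPolynomial (Fin d) k) L]
    [Algebra k L] [IsScalarTower k (MvPolynomial (Fin d) k) L]
    (ρV ρW : G →* (L ≃ₐ[k] L))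
    (hρV : ∀ (g : G) (i : Fin d),
      ρV g (algebraMap (MvPolynomial (Fin d) k) L (MvPolynomial.X i)) =
        (χ i g : k) • algebraMap (MvPolynomial (Fin d) k) L (MvPolynomial.X i))
    (hρW : ∀ (g : G) (i : Fin d),
      ρW g (algebraMap (MvPolynomial (Fin d) k) L (MvPolynomial.X i)) =
        (η i g : k) • algebraMap (MvPolynomial (Fin d) k) L (MvPolynomial.X i))
    (e : L ≃ₐ[k] L)
    (he : ∀ (g : G) (x : L), e (ρV g x) = ρW g (e x)) :
    ExteriorAlgebra.ιMulti ℤ d (fun i => Additive.ofMul (χ i)) =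
      ExteriorAlgebra.ιMulti ℤ d (fun i => Additive.ofMul (η i)) ∨
    ExteriorAlgebra.ιMulti ℤ d (fun i => Additive.ofMul (χ i)) =
      - ExteriorAlgebra.ιMulti ℤ d (fun i => Additive.ofMul (η i)) := by
  obtain ⟨m, hm, h1⟩ := ry_half k G d χ η L ρV ρW hρV hρW e he
  obtain ⟨n, hn, h2⟩ := ry_half k G d η χ L ρW ρV hρW hρV e.symm (fun g x => by
    apply e.injective
    rw [he, e.apply_symm_apply, e.apply_symm_apply])
  rcases hm with rfl | rfl | rfl
  · rcases hn with rfl | rfl | rfl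
    · left
      rw [h1, h2]; simp
    · left
      rw [h2]; simp
    · right
      rw [h2]; simp
  · left
    rw [h1]; simp
  · right
    rw [h1]; simp
end
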